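/- Assume d = 2t+1 is odd, ε ≤ t + r, and that, after renumbering, α_j = α'_j and β_j = β'_j for j = 1,…,r (so α_1,…,α_r are error locators of e with corresponding error values β_1,…,β_r). Then lm(ω,σ) = (0, X^ε) is the minimum of lm(u,v) over all nonzero (u,v) ∈ M_r(S_y; α_1,…,α_r; β_1,…,β_r); equivalently, every nonzero (u,v) ∈ M_r satisfies deg u ≥ ε or deg v ≥ ε. -/

import Mathlib

open Polynomial

noncomputable def synd {F : Type*} [Field F] (n d : ℕ) (ta : Fin n → F) (lam : F)
    (y : Fin n → F) : F[X] :=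
  ∑ j ∈ Finset.range (d - 1), C (∑ i : Fin n, ta i * y i * lam ^ ((i : ℕ) * j)) * X ^ j

/-- The module `M_r(S; α; β)` of the paper: pairs `(u,v)` with `u ≡ S v (mod X^{d-1})`,
`v(α_j⁻¹) = 0` and `β_j a_j v'(α_j⁻¹) = -α_j u(α_j⁻¹)` for all `j`. -/
def Mmod {F : Type*} [Field F] (d : ℕ) (S : F[X]) {r : ℕ} (α β a : Fin r → F) :
    Set (F[X] × F[X]) :=
  { uv | (X : F[X]) ^ (d - 1) ∣ uv.1 - S * uv.2 ∧
      ∀ j : Fin r, uv.2.eval (α j)⁻¹ = 0 ∧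
        β j * a j * ((derivative uv.2).eval (α j)⁻¹) = -(α j * uv.1.eval (α j)⁻¹) }

/-- The error-locator polynomial `σ(X) = ∏ᵢ (1 - αᵢ X)`. -/
noncomputable def elp {F : Type*} [Field F] {ε : ℕ} (α' : Fin ε → F) : F[X] :=
  ∏ i : Fin ε, (1 - C (α' i) * X)

/-- The error-evaluator polynomial `ω(X) = Σᵢ cᵢ ∏_{j≠i} (1 - αⱼ X)` (with `cᵢ = βᵢ aᵢ`). -/
noncomputable def eep {F : Type*} [Field F] {ε : ℕ} (α' c : Fin ε → F) : F[X] :=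
  ∑ i : Fin ε, C (c i) * ∏ j ∈ Finset.univ.erase i, (1 - C (α' j) * X)

/-- Degree of a polynomial, as an element of `WithBot ℤ` (so `deg 0 = ⊥ = -∞`). -/
noncomputable def degZ {F : Type*} [Field F] (p : F[X]) : WithBot ℤ :=
  p.degree.map (fun k : ℕ => (k : ℤ))

/-- The monomial ordering `<_w` on monomials of `F[X]²`: `Sum.inl i` stands for the
monomial `(X^i, 0)` and `Sum.inr j` for `(0, X^j)`. -/
def monLt (w : ℤ) : ℕ ⊕ ℕ → ℕ ⊕ ℕ → Prop
  | Sum.inl i, Sum.inl j => i < j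
  | Sum.inr i, Sum.inr j => i < j
  | Sum.inl i, Sum.inr j => (i : ℤ) ≤ (j : ℤ) + w
  | Sum.inr i, Sum.inl j => (i : ℤ) + w < (j : ℤ)

def monLe (w : ℤ) (m m' : ℕ ⊕ ℕ) : Prop := monLt w m m' ∨ m = m'

/-- The `<_w`-leading monomial of a (nonzero) pair `(u,v) ∈ F[X]²`:
`(X^{deg u}, 0)` if `deg u ≥ deg v + w + 1`, and `(0, X^{deg v})` otherwise. -/
noncomputable def lm {F : Type*} [Field F] (w : ℤ) (u v : F[X]) : ℕ ⊕ ℕ :=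
  if degZ v + (w : WithBot ℤ) + 1 ≤ degZ u then Sum.inl u.natDegree else Sum.inr v.natDegree

section ErrorPolynomials

variable {F : Type*} [Field F] {ε : ℕ}

theorem elp_eq_mul_prod_erase (α : Fin ε → F) (k : Fin ε) :
    elp α = (1 - C (α k) * X) * ∏ j ∈ Finset.univ.erase k, (1 - C (α j) * X) :=
  (Finset.mul_prod_erase _ _ (Finset.mem_univ k)).symm

theorem degree_one_sub_C_mul_X {a : F} (ha : a ≠ 0) : (1 - C a * X : F[X]).degree = 1 := by
  rw [show (1 - C a * X : F[X]) = C (-a) * X + C 1 by simp; ring]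
  exact degree_linear (neg_ne_zero.mpr ha)

theorem degree_elp {α : Fin ε → F} (hα : ∀ k, α k ≠ 0) : (elp α).degree = ε := by
  simp [elp, degree_prod, degree_one_sub_C_mul_X (hα _)]

theorem degree_eep_lt {α : Fin ε → F} (hα : ∀ k, α k ≠ 0) (c : Fin ε → F) :
    (eep α c).degree < ε := by
  refine (degree_sum_le _ _).trans_lt ((Finset.sup_lt_iff (WithBot.bot_lt_coe ε)).2 fun k _ => ?_)
  rw [degree_mul, degree_prod]
  simp only [degree_one_sub_C_mul_X (hα _), Finset.sum_const, Finset.card_erase_of_mem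
    (Finset.mem_univ k), Finset.card_univ, Fintype.card_fin, nsmul_eq_mul, mul_one]
  calc (C (c k)).degree + ((ε - 1 : ℕ) : WithBot ℕ) ≤ 0 + ((ε - 1 : ℕ) : WithBot ℕ) := by
        gcongr; exact degree_C_le
    _ < ε := by
        rw [zero_add]
        exact_mod_cast Nat.sub_lt k.pos one_pos

theorem eval_elp_inv {α : Fin ε → F} (hα : ∀ k, α k ≠ 0) (k : Fin ε) :
    (elp α).eval (α k)⁻¹ = 0 := by
  simp [elp_eq_mul_prod_erase α k, hα k]

theorem eval_derivative_elp_inv {α : Fin ε → F} (hα : ∀ k, α k ≠ 0) (k : Fin ε) :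
    (derivative (elp α)).eval (α k)⁻¹ =
      -(α k * (∏ j ∈ Finset.univ.erase k, (1 - C (α j) * X)).eval (α k)⁻¹) := by
  rw [elp_eq_mul_prod_erase α k, derivative_mul]
  simp [hα k]

theorem eval_eep_inv {α : Fin ε → F} (hα : ∀ k, α k ≠ 0) (c : Fin ε → F) (k : Fin ε) :
    (eep α c).eval (α k)⁻¹ =
      c k * (∏ j ∈ Finset.univ.erase k, (1 - C (α j) * X)).eval (α k)⁻¹ := by
  rw [eep, eval_finsetSum, Finset.sum_eq_single k]
  · simp
  · intro i _ hik
    rw [eval_mul, eval_prod, Finset.prod_eq_zero (i := k)]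
    · simp
    · simp [hik.symm]
    · simp [hα k]
  · simp

theorem eval_prod_erase_inv_ne_zero {α : Fin ε → F} (hα : ∀ k, α k ≠ 0)
    (hinj : Function.Injective α) (k : Fin ε) :
    (∏ j ∈ Finset.univ.erase k, (1 - C (α j) * X)).eval (α k)⁻¹ ≠ 0 := by
  rw [eval_prod, Finset.prod_ne_zero_iff]
  intro j hj h
  have hne : j ≠ k := by simpa using hj
  have h1 : α j * (α k)⁻¹ = 1 := (sub_eq_zero.1 (by simpa using h)).symm
  exact hne (hinj ((mul_inv_eq_one₀ (hα k)).1 h1))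

/-- The key equation. -/
theorem X_pow_dvd_eep_sub_mul_elp (m : ℕ) (α c : Fin ε → F) :
    (X : F[X]) ^ m ∣
      eep α c - (∑ k, C (c k) * ∑ j ∈ Finset.range m, (C (α k) * X) ^ j) * elp α := by
  rw [eep, Finset.sum_mul, ← Finset.sum_sub_distrib]
  refine Finset.dvd_sum fun k _ => ?_
  rw [elp_eq_mul_prod_erase α k]
  have h := geom_sum_mul_neg (C (α k) * X) m
  refine ⟨C (c k) * C (α k) ^ m * ∏ j ∈ Finset.univ.erase k, (1 - C (α j) * X), ?_⟩
  rw [mul_pow] at h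
  linear_combination -(C (c k) * ∏ j ∈ Finset.univ.erase k, (1 - C (α j) * X)) * h

theorem sq_X_sub_C_dvd_of_eval_derivative {p : F[X]} {x : F} (h : p.eval x = 0)
    (h' : (derivative p).eval x = 0) : (X - C x) ^ 2 ∣ p := by
  rcases eq_or_ne p 0 with rfl | hp
  · exact dvd_zero _
  · exact (le_rootMultiplicity_iff hp).1 ((one_lt_rootMultiplicity_iff_isRoot hp).2 ⟨h, h'⟩)

theorem eq_zero_of_X_pow_mul_prod_sq_dvd {ι : Type*} [Fintype ι] {m : ℕ} {x : ι → F}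
    (hx : ∀ j, x j ≠ 0) (hinj : Function.Injective x) {p : F[X]} (h0 : X ^ m ∣ p)
    (h : ∀ j, (X - C (x j)) ^ 2 ∣ p) (hdeg : p.degree < (m + 2 * Fintype.card ι : ℕ)) :
    p = 0 := by
  have hprod : ∏ j, (X - C (x j)) ^ 2 ∣ p :=
    Finset.prod_dvd_of_coprime
      (fun i _ j _ hij => (pairwise_coprime_X_sub_C hinj hij).pow) fun j _ => h j
  have hcop : IsCoprime (X ^ m : F[X]) (∏ j, (X - C (x j)) ^ 2) := by
    refine IsCoprime.prod_right fun j _ => IsCoprime.pow ?_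
    simpa using isCoprime_X_sub_C_of_isUnit_sub (a := (0 : F)) (b := x j) (by simpa using hx j)
  refine eq_zero_of_dvd_of_degree_lt (hcop.mul_dvd h0 hprod) (hdeg.trans_eq ?_)
  rw [degree_mul, degree_X_pow, degree_prod]
  simp [degree_pow, mul_comm]

theorem eq_zero_of_mem_Mmod_of_degree_lt {d r : ℕ} {S : F[X]} {α β a : Fin ε → F}
    (hα : ∀ k, α k ≠ 0) (hinj : Function.Injective α) (hc : ∀ k, β k * a k ≠ 0)
    (hS : (X : F[X]) ^ (d - 1) ∣ eep α (fun k => β k * a k) - S * elp α)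
    (hr : r ≤ ε) (hε : 2 * ε ≤ (d - 1) + 2 * r) {u v : F[X]}
    (huv : (u, v) ∈ Mmod d S (fun j : Fin r => α (Fin.castLE hr j))
      (fun j => β (Fin.castLE hr j)) (fun j => a (Fin.castLE hr j)))
    (hu : u.degree < ε) (hv : v.degree < ε) : u = 0 ∧ v = 0 := by
  obtain ⟨hcong, hroot⟩ := huv
  set ω := eep α (fun k => β k * a k) with hω
  set σ := elp α with hσ
  have hdσ : σ.degree = ε := degree_elp hα
  have hdω : ω.degree < ε := degree_eep_lt hα _
  have hσ0 : σ ≠ 0 := by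
    rintro h
    simp [h] at hdσ
  have hmul : ∀ {p q : F[X]}, p.degree < ε → q.degree ≤ ε → (p * q).degree < (2 * ε : ℕ) := by
    intro p q hp hq
    rcases eq_or_ne q 0 with rfl | hq0
    · rw [mul_zero, degree_zero]
      exact WithBot.bot_lt_coe _
    rw [degree_mul, two_mul, Nat.cast_add]
    exact WithBot.add_lt_add_of_lt_of_le (degree_ne_bot.2 hq0) hp hq
  have key : u * σ - ω * v = 0 := by
    refine eq_zero_of_X_pow_mul_prod_sq_dvd (m := d - 1)
      (x := fun j : Fin r => (α (Fin.castLE hr j))⁻¹) (fun j => inv_ne_zero (hα _))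
      (fun i j h => Fin.castLE_injective hr (hinj (inv_injective h))) ?_ (fun j => ?_) ?_
    · convert (hcong.mul_right σ).sub (hS.mul_right v) using 1
      ring
    · obtain ⟨hv0, hv1⟩ := hroot j
      dsimp only at hv0 hv1
      apply sq_X_sub_C_dvd_of_eval_derivative
      · simp [hσ, eval_elp_inv hα, hv0]
      · simp only [derivative_sub, derivative_mul, eval_sub, eval_add, eval_mul, hσ, hω, hv0,
          eval_elp_inv hα, eval_derivative_elp_inv hα, eval_eep_inv hα]
        linear_combination -(∏ i ∈ Finset.univ.erase (Fin.castLE hr j),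
          (1 - C (α i) * X)).eval (α (Fin.castLE hr j))⁻¹ * hv1
    · refine ((degree_sub_le _ _).trans_lt
        (max_lt (hmul hu hdσ.le) (hmul hdω hv.le))).trans_le ?_
      exact_mod_cast by simpa using hε
  have hv0 : v = 0 := by
    refine eq_zero_of_degree_lt_of_eval_index_eq_zero Finset.univ
      (v := fun k => (α k)⁻¹)
      (fun i _ j _ h => hinj (inv_injective h)) (by simpa using hv) fun k _ => ?_
    have h := congrArg (eval (α k)⁻¹) key
    simp only [eval_sub, eval_mul, hσ, hω, eval_elp_inv hα, eval_eep_inv hα, eval_zero, mul_zero,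
      zero_sub, neg_eq_zero] at h
    exact (mul_eq_zero.1 h).resolve_left
      (mul_ne_zero (hc k) (eval_prod_erase_inv_ne_zero hα hinj k))
  refine ⟨?_, hv0⟩
  simpa [hv0, hσ0] using key

end ErrorPolynomials

theorem synd_add {F : Type*} [Field F] (n d : ℕ) (ta : Fin n → F) (lam : F) (x y : Fin n → F) :
    synd n d ta lam (x + y) = synd n d ta lam x + synd n d ta lam y := by
  simp only [synd, ← Finset.sum_add_distrib, ← add_mul, ← C_add, Pi.add_apply, mul_add]

theorem synd_eq_sum_locators {F : Type*} [Field F] {n ε : ℕ} (d : ℕ) (ta : Fin n → F) (lam : F)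
    (e : Fin n → F) {loc : Fin ε → Fin n} (hloc : Function.Injective loc)
    (hsupp : ∀ i, e i ≠ 0 → ∃ k, loc k = i) :
    synd n d ta lam e = ∑ k, C (e (loc k) * ta (loc k)) *
      ∑ j ∈ Finset.range (d - 1), (C (lam ^ (loc k : ℕ)) * X) ^ j := by
  simp only [Finset.mul_sum]
  rw [Finset.sum_comm, synd]
  refine Finset.sum_congr rfl fun j _ => ?_
  rw [← Fintype.sum_of_injective loc hloc
    (fun k => ta (loc k) * e (loc k) * lam ^ ((loc k : ℕ) * j)) _ (fun i hi => ?_)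
    fun _ => rfl]
  · rw [map_sum, Finset.sum_mul]
    refine Finset.sum_congr rfl fun k _ => ?_
    simp only [map_mul, map_pow, mul_pow, pow_mul]
    ring
  · have : e i = 0 := by_contra fun h => hi (hsupp i h)
    simp [this]

section PrimitiveElement

variable {F : Type*} [Field F] [Fintype F] {lam : F}

theorem card_sub_one_le_one_of_powers_zero (hlam : ∀ z : F, z ≠ 0 → ∃ k : ℕ, z = lam ^ k)
    (h0 : lam = 0) : Fintype.card F - 1 ≤ 1 := by
  classical
  rw [← Fintype.card_units, Fintype.card_le_one_iff]
  have h (z : Fˣ) : (z : F) = 1 := by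
    obtain ⟨k, hk⟩ := hlam z z.ne_zero
    rcases k with _ | k
    · simpa using hk
    · simp [h0] at hk
  exact fun a b => Units.ext ((h a).trans (h b).symm)

theorem pow_ne_zero_of_lt_card_sub_one (hlam : ∀ z : F, z ≠ 0 → ∃ k : ℕ, z = lam ^ k) {i : ℕ}
    (hi : i < Fintype.card F - 1) : lam ^ i ≠ 0 := by
  rcases eq_or_ne lam 0 with h0 | h0
  · have := card_sub_one_le_one_of_powers_zero hlam h0
    obtain rfl : i = 0 := by omega
    simp
  · exact pow_ne_zero _ h0

theorem pow_injOn_of_powers (hlam : ∀ z : F, z ≠ 0 → ∃ k : ℕ, z = lam ^ k) :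
    Set.InjOn (fun i : ℕ => lam ^ i) (Set.Iio (Fintype.card F - 1)) := by
  classical
  rcases eq_or_ne lam 0 with h0 | h0
  · have := card_sub_one_le_one_of_powers_zero hlam h0
    intro i hi j hj _
    simp only [Set.mem_Iio] at hi hj
    omega
  · have hgen : ∀ z : Fˣ, z ∈ Subgroup.zpowers (Units.mk0 lam h0) := fun z => by
      obtain ⟨k, hk⟩ := hlam z z.ne_zero
      exact ⟨k, Units.ext (by simp [hk])⟩
    have hord : orderOf (Units.mk0 lam h0) = Fintype.card F - 1 := by
      rw [orderOf_eq_card_of_forall_mem_zpowers hgen, Nat.card_eq_fintype_card,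
        Fintype.card_units]
    intro i hi j hj hij
    rw [← hord] at hi hj
    exact pow_injOn_Iio_orderOf hi hj (Units.ext (by simpa using hij))

end PrimitiveElement

section LeadingMonomial

variable {F : Type*} [Field F]

theorem lm_neg_one (u v : F[X]) :
    lm (-1) u v = if v.degree ≤ u.degree then Sum.inl u.natDegree else Sum.inr v.natDegree := by
  have h : degZ v + ((-1 : ℤ) : WithBot ℤ) + 1 ≤ degZ u ↔ v.degree ≤ u.degree := by
    unfold degZ
    cases u.degree <;> cases v.degree
    · simp
    · simp [← WithBot.coe_one, ← WithBot.coe_add]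
    · simp
    · simp [← WithBot.coe_one, ← WithBot.coe_add]
  simp only [lm, h]

theorem monLe_inr_lm_neg_one {m : ℕ} {u v : F[X]}
    (h : ¬(u.degree < m ∧ v.degree < m)) : monLe (-1) (Sum.inr m) (lm (-1) u v) := by
  rw [lm_neg_one]
  split_ifs with hle
  · have hu : (m : WithBot ℕ) ≤ u.degree := not_lt.1 fun hu => h ⟨hu, hle.trans_lt hu⟩
    have := le_natDegree_of_coe_le_degree hu
    left
    simp only [monLt]
    omega
  · have hv : (m : WithBot ℕ) ≤ v.degree :=
      not_lt.1 fun hv => h ⟨(not_le.1 hle).trans hv, hv⟩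
    rcases (le_natDegree_of_coe_le_degree hv).lt_or_eq with h | h
    · exact Or.inl h
    · exact Or.inr (congrArg _ h)

end LeadingMonomial

/-- with `d = 2t+1`, `ε ≤ t + r`, and `α₁,…,α_r` error locators with
corresponding error values `β₁,…,β_r`, the leading monomial of `(ω,σ)` (w.r.t. the
ordering `<_{-1}` of the paper) is `(0, X^ε)`, and it is minimal among the leading
monomials of the nonzero elements of `M_r(S_y; α; β)`. -/
theorem stmt2 {F : Type*} [Field F] [Fintype F]
    (n d : ℕ) (hn : n = Fintype.card F - 1) (hd : 2 ≤ d)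
    (t : ℕ) (hdt : d = 2 * t + 1)
    (lam : F) (hlam : ∀ z : F, z ≠ 0 → ∃ k : ℕ, z = lam ^ k)
    (ta : Fin n → F) (hta : ∀ i, ta i ≠ 0)
    (x e y : Fin n → F) (hy : y = x + e)
    (hx : synd n d ta lam x = 0)
    (ε : ℕ) (loc : Fin ε → Fin n) (hloc : Function.Injective loc)
    (hsupp : ∀ i : Fin n, e i ≠ 0 ↔ ∃ k, loc k = i)
    (r : ℕ) (hr : r ≤ ε) (hεtr : ε ≤ t + r) :
    lm (-1) (eep (fun k => lam ^ ((loc k : ℕ))) (fun k => e (loc k) * ta (loc k)))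
        (elp (fun k => lam ^ ((loc k : ℕ)))) = Sum.inr ε ∧
      ∀ uv : F[X] × F[X],
        uv ∈ Mmod d (synd n d ta lam y)
            (fun j : Fin r => lam ^ ((loc (Fin.castLE hr j) : ℕ)))
            (fun j : Fin r => e (loc (Fin.castLE hr j)))
            (fun j : Fin r => ta (loc (Fin.castLE hr j))) →
        uv ≠ (0, 0) → monLe (-1) (Sum.inr ε) (lm (-1) uv.1 uv.2) := by
  subst hn
  have hα : ∀ k, lam ^ (loc k : ℕ) ≠ 0 := fun k =>
    pow_ne_zero_of_lt_card_sub_one hlam (loc k).isLt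
  have hinj : Function.Injective fun k => lam ^ (loc k : ℕ) := fun i j h =>
    hloc (Fin.ext (pow_injOn_of_powers hlam (loc i).isLt (loc j).isLt h))
  refine ⟨?_, ?_⟩
  · rw [lm_neg_one, if_neg, natDegree_eq_of_degree_eq_some (degree_elp hα)]
    rw [degree_elp hα]
    exact not_le.2 (degree_eep_lt hα _)
  · rintro ⟨u, v⟩ huv hne
    refine monLe_inr_lm_neg_one fun ⟨hu, hv⟩ => hne ?_
    have hS : (X : F[X]) ^ (d - 1) ∣ eep (fun k => lam ^ (loc k : ℕ))
        (fun k => e (loc k) * ta (loc k)) -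
          synd _ d ta lam y * elp (fun k => lam ^ (loc k : ℕ)) := by
      rw [hy, synd_add, hx, zero_add,
        synd_eq_sum_locators d ta lam e hloc fun i => (hsupp i).1]
      exact X_pow_dvd_eep_sub_mul_elp (d - 1) _ _
    exact Prod.ext_iff.2 (eq_zero_of_mem_Mmod_of_degree_lt
      (β := fun k => e (loc k)) (a := fun k => ta (loc k)) hα hinj
      (fun k => mul_ne_zero ((hsupp _).2 ⟨k, rfl⟩) (hta _)) hS hr (by omega) huv hu hv)
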